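/- arXiv:2107.01266 — 2 statements merged into one kernel-verified Lean document; each statement's English description precedes it below -/
import Mathlib

section
/- For every μ ∈ ℝ, τ > 0 and b ∈ ℝ, with Z a standard normal random variable, E[max(μ + τZ − b, 0)²] = τ²·T((b − μ)/τ). -/
noncomputable section

/-- Standard normal density `φ(z) = exp(−z²/2)/√(2π)`. -/
def gpdf (z : ℝ) : ℝ := Real.exp (-z ^ 2 / 2) / Real.sqrt (2 * Real.pi)

/-- Standard normal cumulative distribution function `Φ(z) = ∫_{−∞}^z φ(x) dx`. -/
def gcdf (z : ℝ) : ℝ := ∫ x in Set.Iic z, gpdf x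

/-- `T(z) = (1 + z²)Φ(−z) − zφ(z)`. -/
def Tfun (z : ℝ) : ℝ := (1 + z ^ 2) * gcdf (-z) - z * gpdf z

open MeasureTheory Set Filter Topology

lemma integrable_pow_mul_gpdf (n : ℕ) : Integrable fun z : ℝ => z ^ n * gpdf z := by
  have h := integrable_rpow_mul_exp_neg_mul_sq (b := 1 / 2) (by norm_num)
    (s := (n : ℝ)) (by have := n.cast_nonneg (α := ℝ); linarith)
  refine (h.div_const (Real.sqrt (2 * Real.pi))).congr (Eventually.of_forall fun z => ?_)
  simp only [gpdf, Real.rpow_natCast]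
  rw [mul_div_assoc]
  congr 3
  ring

lemma integrable_gpdf : Integrable gpdf := by
  simpa using integrable_pow_mul_gpdf 0

lemma hasDerivAt_gpdf (z : ℝ) : HasDerivAt gpdf (-z * gpdf z) z := by
  have h : HasDerivAt (fun x : ℝ => -x ^ 2 / 2) (-z) z := by
    refine ((hasDerivAt_pow 2 z).neg.div_const 2).congr_deriv ?_
    norm_num
    ring
  refine (h.exp.div_const (Real.sqrt (2 * Real.pi))).congr_deriv ?_
  simp only [gpdf]
  ring

lemma setIntegral_Ioi_gpdf (c : ℝ) : ∫ z in Ioi c, gpdf z = gcdf (-c) := by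
  rw [gcdf, ← integral_comp_neg_Ioi]
  simp [gpdf]

lemma setIntegral_Ioi_sub_sq_mul_gpdf (c : ℝ) :
    ∫ z in Ioi c, (z - c) ^ 2 * gpdf z = Tfun c := by
  have h0 := integrable_gpdf
  have h1 : Integrable fun z : ℝ => z * gpdf z := by
    simpa using integrable_pow_mul_gpdf 1
  have h2 := integrable_pow_mul_gpdf 2
  have hderiv (z : ℝ) : HasDerivAt (fun x => (2 * c - x) * gpdf x)
      ((z ^ 2 - 2 * c * z - 1) * gpdf z) z := by
    refine (((hasDerivAt_id z).const_sub (2 * c)).mul (hasDerivAt_gpdf z)).congr_deriv ?_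
    simp only [id]
    ring
  have hf : Integrable fun z : ℝ => (2 * c - z) * gpdf z := by
    simp only [sub_mul]
    exact (h0.const_mul (2 * c)).sub h1
  have hf' : Integrable fun z : ℝ => (z ^ 2 - 2 * c * z - 1) * gpdf z := by
    refine ((h2.sub (h1.const_mul (2 * c))).sub h0).congr (Eventually.of_forall fun z => ?_)
    simp only [Pi.sub_apply]
    ring
  have hlim := tendsto_zero_of_hasDerivAt_of_integrableOn_Ioi (a := c)
    (fun z _ => hderiv z) hf'.integrableOn hf.integrableOn
  have hint := integral_Ioi_of_hasDerivAt_of_tendsto' (a := c)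
    (fun z _ => hderiv z) hf'.integrableOn hlim
  have hsplit (z : ℝ) : (z - c) ^ 2 * gpdf z =
      (1 + c ^ 2) * gpdf z + (z ^ 2 - 2 * c * z - 1) * gpdf z := by ring
  simp_rw [hsplit]
  rw [integral_add (h0.const_mul _).integrableOn hf'.integrableOn, hint, integral_const_mul,
    setIntegral_Ioi_gpdf, Tfun]
  ring

/-- second moment of the one-sided soft-thresholded Gaussian:
`E[max(μ + τZ − b, 0)²] = τ²T((b − μ)/τ)`. -/
theorem oneSided_softThresh_second_moment (μ τ b : ℝ) (hτ : 0 < τ) :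
    (∫ z : ℝ, max (μ + τ * z - b) 0 ^ 2 * gpdf z) = τ ^ 2 * Tfun ((b - μ) / τ) := by
  set c := (b - μ) / τ with hc
  have hz (z : ℝ) : μ + τ * z - b = τ * (z - c) := by
    rw [hc]
    field_simp
    ring
  have hind : (fun z : ℝ => max (μ + τ * z - b) 0 ^ 2 * gpdf z) =
      (Ioi c).indicator fun z => τ ^ 2 * ((z - c) ^ 2 * gpdf z) := by
    ext z
    rw [hz]
    by_cases h : c < z
    · rw [indicator_of_mem (mem_Ioi.2 h),
        max_eq_left (mul_nonneg hτ.le (sub_nonneg.2 h.le))]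
      ring
    · rw [indicator_of_notMem (by simpa using h), max_eq_right
        (mul_nonpos_of_nonneg_of_nonpos hτ.le (sub_nonpos.2 (not_lt.1 h)))]
      ring
  rw [hind, integral_indicator measurableSet_Ioi, integral_const_mul,
    setIntegral_Ioi_sub_sq_mul_gpdf]
end
end

section
/- For δ > 0 and γ ∈ [0,1], define A(γ) = {α ≥ 0 : δ ≥ 2T(γα) − 2(1−γ)α√(2T(γα)) + (1−γ)²α²} (equivalently, δ ≥ (√(2T(γα)) − (1−γ)α)²). If γ < 1, then A(γ) is bounded above. If γ = 1, then A(1) is unbounded above: there exists α₀ ≥ 0 such that every α ≥ α₀ belongs to A(1). -/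
noncomputable section

/-- The set `A(γ) = {α ≥ 0 : δ ≥ 2T(γα) − 2(1−γ)α√(2T(γα)) + (1−γ)²α²}`. -/
def ampSet (δ γ : ℝ) : Set ℝ :=
  {α : ℝ | 0 ≤ α ∧
    2 * Tfun (γ * α) - 2 * (1 - γ) * α * Real.sqrt (2 * Tfun (γ * α))
      + (1 - γ) ^ 2 * α ^ 2 ≤ δ}

theorem gpdf_nonneg (z : ℝ) : 0 ≤ gpdf z := by
  unfold gpdf
  positivity

theorem gpdf_le_exp (z : ℝ) : gpdf z ≤ Real.exp (1 / 2) * Real.exp z := by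
  have hsqrt : 1 ≤ Real.sqrt (2 * Real.pi) := by
    rw [Real.one_le_sqrt]
    linarith [Real.pi_gt_three]
  unfold gpdf
  rw [← Real.exp_add]
  refine (div_le_self (Real.exp_pos _).le hsqrt).trans (Real.exp_le_exp.2 ?_)
  nlinarith [sq_nonneg (z + 1)]

theorem gpdf_neg (z : ℝ) : gpdf (-z) = gpdf z := by
  simp [gpdf]

theorem gcdf_nonneg (z : ℝ) : 0 ≤ gcdf z :=
  MeasureTheory.integral_nonneg gpdf_nonneg

theorem gcdf_le_exp (z : ℝ) : gcdf z ≤ Real.exp (1 / 2) * Real.exp z := by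
  unfold gcdf
  calc ∫ x in Set.Iic z, gpdf x ≤ ∫ x in Set.Iic z, Real.exp (1 / 2) * Real.exp x :=
        MeasureTheory.integral_mono_of_nonneg (Filter.Eventually.of_forall gpdf_nonneg)
          ((integrableOn_exp_Iic z).const_mul _) (Filter.Eventually.of_forall gpdf_le_exp)
    _ = Real.exp (1 / 2) * Real.exp z := by
        rw [MeasureTheory.integral_const_mul, integral_exp_Iic]

theorem abs_Tfun_le {z : ℝ} (hz : 0 ≤ z) :
    |Tfun z| ≤ Real.exp (1 / 2) * ((1 + z + z ^ 2) * Real.exp (-z)) := by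
  have h₁ := mul_le_mul_of_nonneg_left (gcdf_le_exp (-z)) (by positivity : 0 ≤ 1 + z ^ 2)
  have h₂ := mul_le_mul_of_nonneg_left (gpdf_neg z ▸ gpdf_le_exp (-z)) hz
  have h₃ := mul_nonneg (by positivity : 0 ≤ 1 + z ^ 2) (gcdf_nonneg (-z))
  have h₄ := mul_nonneg hz (gpdf_nonneg z)
  have h₅ : 0 ≤ (1 + z ^ 2) * (Real.exp (1 / 2) * Real.exp (-z)) := by positivity
  have h₆ : 0 ≤ z * (Real.exp (1 / 2) * Real.exp (-z)) := by positivity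
  unfold Tfun
  rw [abs_le]
  constructor <;> nlinarith

theorem abs_Tfun_le_const {z : ℝ} (hz : 0 ≤ z) : |Tfun z| ≤ 2 * Real.exp (1 / 2) := by
  have h : (1 + z + z ^ 2) * Real.exp (-z) ≤ 2 := by
    rw [Real.exp_neg, ← div_eq_mul_inv, div_le_iff₀ (Real.exp_pos z)]
    nlinarith [Real.quadratic_le_exp_of_nonneg hz]
  nlinarith [abs_Tfun_le hz, mul_le_mul_of_nonneg_left h (Real.exp_pos (1 / 2)).le]

theorem tendsto_Tfun_atTop : Filter.Tendsto Tfun Filter.atTop (nhds 0) := by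
  have h : Filter.Tendsto (fun z : ℝ => Real.exp (1 / 2) * ((1 + z + z ^ 2) * Real.exp (-z)))
      Filter.atTop (nhds 0) := by
    have h₀ := Real.tendsto_pow_mul_exp_neg_atTop_nhds_zero 0
    have h₁ := Real.tendsto_pow_mul_exp_neg_atTop_nhds_zero 1
    have h₂ := Real.tendsto_pow_mul_exp_neg_atTop_nhds_zero 2
    simpa [add_mul] using ((h₀.add h₁).add h₂).const_mul (Real.exp (1 / 2))
  refine squeeze_zero_norm' ?_ h
  filter_upwards [Filter.eventually_ge_atTop 0] with z hz
  exact abs_Tfun_le hz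

theorem bddAbove_ampSet {δ γ : ℝ} (hδ : 0 < δ) (hγ0 : 0 ≤ γ) (hγ1 : γ < 1) :
    BddAbove (ampSet δ γ) := by
  set M := 2 * Real.exp (1 / 2)
  have hM : 0 < M := by positivity
  set S := Real.sqrt (2 * M)
  have hS : 0 ≤ S := Real.sqrt_nonneg _
  refine ⟨(δ + 2 * M + 2 * S + 1) / (1 - γ), ?_⟩
  rintro α ⟨hα, h⟩
  rw [le_div_iff₀ (by linarith)]
  have hT := abs_le.1 (abs_Tfun_le_const (mul_nonneg hγ0 hα))
  have hs : Real.sqrt (2 * Tfun (γ * α)) ≤ S := Real.sqrt_le_sqrt (by linarith [hT.2])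
  have hb : 0 ≤ (1 - γ) * α := mul_nonneg (by linarith) hα
  have hbs := mul_le_mul_of_nonneg_left hs hb
  by_contra! hlt
  have hsq : ((1 - γ) * α) ^ 2 ≤ δ + 2 * M + 2 * ((1 - γ) * α * S) := by
    nlinarith [hT.1]
  have hlt' : δ + 2 * M + 2 * S + 1 < (1 - γ) * α := by linarith
  generalize (1 - γ) * α = b at *
  nlinarith [mul_le_mul_of_nonneg_left hlt'.le hb,
    mul_nonneg (by linarith : 0 ≤ b - 1) (by linarith : 0 ≤ δ + 2 * M)]

theorem exists_forall_mem_ampSet_one {δ : ℝ} (hδ : 0 < δ) :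
    ∃ α₀ : ℝ, 0 ≤ α₀ ∧ ∀ α : ℝ, α₀ ≤ α → α ∈ ampSet δ 1 := by
  obtain ⟨a, ha⟩ := Filter.eventually_atTop.1
    (tendsto_Tfun_atTop.eventually_lt_const (half_pos hδ))
  refine ⟨max a 0, le_max_right _ _, fun α hα => ⟨(le_max_right _ _).trans hα, ?_⟩⟩
  have := ha α ((le_max_left _ _).trans hα)
  rw [one_mul]
  nlinarith

/-- for `γ < 1`, `A(γ)` is bounded above; for `γ = 1`, `A(1)` is
unbounded above: all sufficiently large `α` belong to it. -/
theorem ampSet_bounded_iff (δ γ : ℝ) (hδ : 0 < δ) (hγ0 : 0 ≤ γ) (hγ1 : γ ≤ 1) :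
    (γ < 1 → BddAbove (ampSet δ γ)) ∧
      (γ = 1 → ∃ α₀ : ℝ, 0 ≤ α₀ ∧ ∀ α : ℝ, α₀ ≤ α → α ∈ ampSet δ 1) := by
  exact ⟨bddAbove_ampSet hδ hγ0, fun _ => exists_forall_mem_ampSet_one hδ⟩
end
end
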